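/- With M = L ⊕ U (L = U^a ⊕ E₈(−1)^b, a ≥ 1), R₀ = {δ ∈ M : ⟨δ,δ⟩ = −2, ⟨δ,e⟩ = 0}, R₁ = {δ ∈ M : ⟨δ,δ⟩ = −2, ⟨δ,e⟩ = 1}, and Γ₃ the group generated by O⁺(L) ⊕ id_U, the Eichler transvections t_λ (λ ∈ L), and the reflections s_δ for δ ∈ R₁: for every δ ∈ R₀ there exists σ ∈ Γ₃ such that σ(δ) ∈ R₁. -/

import Mathlib

noncomputable section

open scoped BigOperators

/-- Index type for the even unimodular lattice `L = U^a ⊕ E₈(-1)^b`. -/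
abbrev LIdx (a b : ℕ) := (Fin a × Fin 2) ⊕ (Fin b × Fin 8)

/-- Elements of the lattice `L = U^a ⊕ E₈(-1)^b`. -/
abbrev LVec (a b : ℕ) := LIdx a b → ℤ

/-- The Gram matrix of `U^a ⊕ E₈(-1)^b`. -/
def gramL (a b : ℕ) : LIdx a b → LIdx a b → ℤ := fun i j =>
  match i, j with
  | Sum.inl (k, s), Sum.inl (k', s') => if k = k' ∧ s ≠ s' then 1 else 0
  | Sum.inr (k, s), Sum.inr (k', s') => if k = k' then -(CartanMatrix.E₈ s s') else 0
  | _, _ => 0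

/-- The bilinear form of `L = U^a ⊕ E₈(-1)^b`. -/
def BL (a b : ℕ) (x y : LVec a b) : ℤ :=
  ∑ i, ∑ j, x i * gramL a b i j * y j

/-- Index type for `M = L ⊕ U`; the extra hyperbolic summand has basis `f = inr 0`,
`e = inr 1`.  An element `v + m f + n e` of `M` is the function sending `inl i` to `v i`,
`inr 0` to `m` and `inr 1` to `n`. -/
abbrev MIdx (a b : ℕ) := LIdx a b ⊕ Fin 2

/-- Elements of `M = L ⊕ U`. -/
abbrev MVec (a b : ℕ) := MIdx a b → ℤ

/-- The bilinear form of `M = L ⊕ U`: `⟨v + m f + n e, v' + m' f + n' e⟩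
  = ⟨v,v'⟩_L + m n' + n m'`. -/
def BM (a b : ℕ) (x y : MVec a b) : ℤ :=
  BL a b (fun i => x (Sum.inl i)) (fun i => y (Sum.inl i)) +
    x (Sum.inr 0) * y (Sum.inr 1) + x (Sum.inr 1) * y (Sum.inr 0)

/-- The basis vector `e` of the last hyperbolic summand of `M = L ⊕ U`. -/
def eM (a b : ℕ) : MVec a b := fun i => if i = Sum.inr 1 then 1 else 0

/-- The ℝ-bilinear extension of the form of `L = U^a ⊕ E₈(-1)^b` to `L ⊗ ℝ`. -/
def BLR (a b : ℕ) (x y : LIdx a b → ℝ) : ℝ :=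
  ∑ i, ∑ j, x i * (gramL a b i j : ℝ) * y j

/-- The ℝ-linear extension of a ℤ-linear automorphism of `ι → ℤ` to `ι → ℝ`. -/
def realExt {ι : Type} [Fintype ι] [DecidableEq ι] (φ : (ι → ℤ) ≃ₗ[ℤ] (ι → ℤ)) :
    (ι → ℝ) →ₗ[ℝ] (ι → ℝ) :=
  Matrix.toLin'
    ((LinearMap.toMatrix' (φ : (ι → ℤ) →ₗ[ℤ] (ι → ℤ))).map fun z : ℤ => (z : ℝ))

/-- `φ` preserves the orientation of maximal positive-definite subspaces of `L ⊗ ℝ`: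
for some `a`-dimensional subspace `P` of `L ⊗ ℝ` on which the form is positive definite,
the composite of the real extension of `φ` restricted to `P` with the orthogonal projection
back onto `P` has positive determinant. -/
def PresOrient (a b : ℕ) (φ : LVec a b ≃ₗ[ℤ] LVec a b) : Prop :=
  ∃ P : Submodule ℝ (LIdx a b → ℝ),
    Module.finrank ℝ P = a ∧
    (∀ v ∈ P, v ≠ 0 → 0 < BLR a b v v) ∧
    ∃ proj : (LIdx a b → ℝ) →ₗ[ℝ] P,
      (∀ p : P, proj (p : LIdx a b → ℝ) = p) ∧
      (∀ v : LIdx a b → ℝ, ∀ p ∈ P, BLR a b (v - (proj v : LIdx a b → ℝ)) p = 0) ∧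
      0 < LinearMap.det (proj ∘ₗ realExt φ ∘ₗ P.subtype)

/-- The automorphisms of `M = L ⊕ U` of the form `φ ⊕ id_U` with `φ ∈ O⁺(L)`. -/
def SOplus (a b : ℕ) : Set (MVec a b ≃ₗ[ℤ] MVec a b) :=
  {σ | (∀ x s, σ x (Sum.inr s) = x (Sum.inr s)) ∧
    ∃ φ : LVec a b ≃ₗ[ℤ] LVec a b,
      (∀ u w, BL a b (φ u) (φ w) = BL a b u w) ∧ PresOrient a b φ ∧
      ∀ x i, σ x (Sum.inl i) = φ (fun i' => x (Sum.inl i')) i}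

/-- The Eichler transvections `t_λ` of `M = L ⊕ U`, for `λ ∈ L`:
`t_λ(v + m f + n e) = (v + mλ) + m f + (n - ⟨v,λ⟩ - m⟨λ,λ⟩/2) e` (stated with the last
component doubled, since `⟨λ,λ⟩` is even). -/
def STransv (a b : ℕ) : Set (MVec a b ≃ₗ[ℤ] MVec a b) :=
  {σ | ∃ lam : LVec a b, ∀ x,
    (∀ i, σ x (Sum.inl i) = x (Sum.inl i) + x (Sum.inr 0) * lam i) ∧
    σ x (Sum.inr 0) = x (Sum.inr 0) ∧
    2 * σ x (Sum.inr 1) =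
      2 * x (Sum.inr 1) - 2 * BL a b (fun i => x (Sum.inl i)) lam -
        x (Sum.inr 0) * BL a b lam lam}

/-- The reflections `s_δ : x ↦ x + ⟨x,δ⟩δ` in the elements of
`R₁ = {δ : ⟨δ,δ⟩ = -2, ⟨δ,e⟩ = 1}`. -/
def SRefl (a b : ℕ) : Set (MVec a b ≃ₗ[ℤ] MVec a b) :=
  {σ | ∃ δ : MVec a b, BM a b δ δ = -2 ∧ BM a b δ (eM a b) = 1 ∧
    ∀ x, σ x = x + BM a b x δ • δ}

/-- The subgroup `Γ₃` of `O(M)` generated by `O⁺(L) ⊕ id_U`, the Eichler transvections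
`t_λ` for `λ ∈ L`, and the reflections in the norm `-2` vectors `δ` with `⟨δ,e⟩ = 1`. -/
def Gamma3 (a b : ℕ) : Subgroup (MVec a b ≃ₗ[ℤ] MVec a b) :=
  Subgroup.closure (SOplus a b ∪ STransv a b ∪ SRefl a b)

/-- The form of `U^a ⊕ E₈(-1)^b` as a sum over its orthogonal summands. -/
theorem BL_eq_sum_blocks (a b : ℕ) (x y : LVec a b) :
    BL a b x y =
      ∑ k, (x (Sum.inl (k, 0)) * y (Sum.inl (k, 1)) + x (Sum.inl (k, 1)) * y (Sum.inl (k, 0))) -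
        ∑ k, ∑ s, ∑ t, x (Sum.inr (k, s)) * CartanMatrix.E₈ s t * y (Sum.inr (k, t)) := by
  have hU : ∀ k : Fin a, ∀ s : Fin 2,
      ∑ j, x (Sum.inl (k, s)) * gramL a b (Sum.inl (k, s)) j * y j =
        x (Sum.inl (k, s)) * y (Sum.inl (k, 1 - s)) := by
    intro k s
    rw [Fintype.sum_sum_type, Fintype.sum_prod_type, Finset.sum_eq_single k]
    · fin_cases s <;> simp [gramL]
    · intro l _ hl
      simp [gramL, hl.symm]
    · simp
  have hE : ∀ k : Fin b, ∀ s : Fin 8,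
      ∑ j, x (Sum.inr (k, s)) * gramL a b (Sum.inr (k, s)) j * y j =
        -∑ t, x (Sum.inr (k, s)) * CartanMatrix.E₈ s t * y (Sum.inr (k, t)) := by
    intro k s
    rw [Fintype.sum_sum_type, Fintype.sum_prod_type, Fintype.sum_prod_type,
      Finset.sum_eq_single (s := (Finset.univ : Finset (Fin b))) k]
    · simp [gramL]
    · intro l _ hl
      simp [gramL, hl.symm]
    · simp
  rw [BL, Fintype.sum_sum_type, Fintype.sum_prod_type, Fintype.sum_prod_type]
  simp only [hU, hE, Fin.sum_univ_two, Finset.sum_neg_distrib, sub_eq_add_neg]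
  simp

theorem BL_add_left (a b : ℕ) (x x' y : LVec a b) :
    BL a b (x + x') y = BL a b x y + BL a b x' y := by
  simp [BL, add_mul, Finset.sum_add_distrib]

theorem BL_smul_left (a b : ℕ) (c : ℤ) (x y : LVec a b) :
    BL a b (c • x) y = c * BL a b x y := by
  simp only [BL, Finset.mul_sum, Pi.smul_apply, smul_eq_mul, mul_assoc]

theorem BL_comm (a b : ℕ) (x y : LVec a b) : BL a b x y = BL a b y x := by
  rw [BL_eq_sum_blocks, BL_eq_sum_blocks]
  congr 1
  · exact Finset.sum_congr rfl fun k _ => by ring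
  · refine Finset.sum_congr rfl fun k _ => ?_
    rw [Finset.sum_comm]
    refine Finset.sum_congr rfl fun s _ => Finset.sum_congr rfl fun t _ => ?_
    rw [← CartanMatrix.E₈_isSymm.apply s t]
    ring

theorem even_E₈_quadratic (x : Fin 8 → ℤ) :
    Even (∑ s, ∑ t, x s * CartanMatrix.E₈ s t * x t) := by
  refine ⟨∑ s, x s * x s - (x 0 * x 2 + x 1 * x 3 + x 2 * x 3 + x 3 * x 4 + x 4 * x 5 +
    x 5 * x 6 + x 6 * x 7), ?_⟩
  simp [Fin.sum_univ_succ, CartanMatrix.E₈]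
  ring

theorem even_BL_self (a b : ℕ) (x : LVec a b) : Even (BL a b x x) := by
  rw [BL_eq_sum_blocks]
  refine Even.sub (Finset.even_sum _ fun k _ => ⟨x (Sum.inl (k, 0)) * x (Sum.inl (k, 1)), ?_⟩)
    (Finset.even_sum _ fun k _ => even_E₈_quadratic fun s => x (Sum.inr (k, s)))
  ring

/-- Since `L` is unimodular, a divisor of all values `⟨v, w⟩` divides `v`. -/
theorem dvd_of_forall_dvd_BL (a b : ℕ) (d : ℤ) (v : LVec a b) (h : ∀ w, d ∣ BL a b v w)
    (i : LIdx a b) : d ∣ v i := by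
  rcases i with ⟨k, s⟩ | ⟨k, s⟩
  · have := h (Pi.single (Sum.inl (k, 1 - s)) 1)
    rw [BL_eq_sum_blocks] at this
    fin_cases s <;> simpa [Pi.single_apply] using this
  · have hv : ∀ t, d ∣ (Matrix.vecMul (fun r => v (Sum.inr (k, r))) CartanMatrix.E₈) t := by
      intro t
      have := h (Pi.single (Sum.inr (k, t)) 1)
      rw [BL_eq_sum_blocks] at this
      simpa [Pi.single_apply, ite_and, Matrix.vecMul, dotProduct] using this
    have hs : v (Sum.inr (k, s)) =
        Matrix.vecMul (Matrix.vecMul (fun r => v (Sum.inr (k, r))) CartanMatrix.E₈)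
          CartanMatrix.E₈.adjugate s := by
      rw [Matrix.vecMul_vecMul, Matrix.mul_adjugate, CartanMatrix.E₈_det]
      simp
    rw [hs, Matrix.vecMul, dotProduct]
    exact Finset.dvd_sum fun t _ => (hv t).mul_right _

theorem exists_BL_eq_of_norm_neg_two (a b : ℕ) (v : LVec a b) (hv : BL a b v v = -2) (c : ℤ) :
    ∃ w, BL a b v w = c := by
  let φ : LVec a b →+ ℤ := AddMonoidHom.mk' (fun w => BL a b w v) fun x y => BL_add_left a b x y v
  obtain ⟨d, hd⟩ := Int.subgroup_cyclic φ.range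
  have hdvd : ∀ w, d ∣ BL a b v w := by
    intro w
    have hw : φ w ∈ φ.range := ⟨w, rfl⟩
    rw [hd, ← AddSubgroup.zmultiples_eq_closure, Int.mem_zmultiples_iff] at hw
    rwa [BL_comm]
  choose u hu using dvd_of_forall_dvd_BL a b d v hdvd
  obtain rfl : v = d • u := funext hu
  obtain ⟨q, hq⟩ := even_BL_self a b u
  rw [BL_smul_left, BL_comm, BL_smul_left, hq] at hv
  have hone : d ∣ 1 := ⟨-(d * q), by linarith⟩
  have hc : c ∈ φ.range := by
    rw [hd, ← AddSubgroup.zmultiples_eq_closure, Int.mem_zmultiples_iff]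
    exact hone.trans (one_dvd c)
  obtain ⟨w, hw⟩ := hc
  exact ⟨w, by rw [BL_comm]; exact hw⟩

theorem BM_add_left (a b : ℕ) (x x' y : MVec a b) :
    BM a b (x + x') y = BM a b x y + BM a b x' y := by
  have := BL_add_left a b (fun i => x (Sum.inl i)) (fun i => x' (Sum.inl i))
    fun i => y (Sum.inl i)
  simp only [BM, Pi.add_apply] at *
  simp only [Pi.add_def] at this
  rw [this]
  ring

theorem BM_smul_left (a b : ℕ) (c : ℤ) (x y : MVec a b) :
    BM a b (c • x) y = c * BM a b x y := by
  have := BL_smul_left a b c (fun i => x (Sum.inl i)) fun i => y (Sum.inl i)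
  simp only [Pi.smul_def, smul_eq_mul] at this
  simp only [BM, Pi.smul_apply, smul_eq_mul]
  rw [this]
  ring

theorem BM_comm (a b : ℕ) (x y : MVec a b) : BM a b x y = BM a b y x := by
  rw [BM, BM, BL_comm]
  ring

theorem BM_eM (a b : ℕ) (x : MVec a b) : BM a b x (eM a b) = x (Sum.inr 0) := by
  simp [BM, eM, BL]

/-- Pairing with a fixed vector of `M`, as a linear form. -/
def pairingM (a b : ℕ) (y : MVec a b) : Module.Dual ℤ (MVec a b) where
  toFun x := BM a b x y
  map_add' x x' := BM_add_left a b x x' y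
  map_smul' c x := BM_smul_left a b c x y

/-- For every `δ ∈ R₀` (norm `-2`, `⟨δ,e⟩ = 0`) there is `σ ∈ Γ₃` with `σ(δ) ∈ R₁`
(norm `-2`, `⟨σ(δ),e⟩ = 1`). -/
theorem statement13 (a b : ℕ) (ha : 1 ≤ a) (δ : MVec a b)
    (hδ : BM a b δ δ = -2) (he : BM a b δ (eM a b) = 0) :
    ∃ σ ∈ Gamma3 a b, BM a b (σ δ) (σ δ) = -2 ∧ BM a b (σ δ) (eM a b) = 1 := by
  rw [BM_eM] at he
  have hv : BL a b (fun i => δ (Sum.inl i)) (fun i => δ (Sum.inl i)) = -2 := by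
    simpa [BM, he] using hδ
  obtain ⟨w, hw⟩ := exists_BL_eq_of_norm_neg_two a b _ hv (1 - δ (Sum.inr 1))
  obtain ⟨q, hq⟩ := even_BL_self a b w
  let ρ : MVec a b := Sum.elim w ![1, -1 - q]
  have hρ : BM a b ρ ρ = -2 := by
    simp [ρ, BM, hq]
    ring
  have hρe : BM a b ρ (eM a b) = 1 := by simp [BM_eM, ρ]
  have hδρ : BM a b δ ρ = 1 := by simp [ρ, BM, hw, he]
  have htwo : (-pairingM a b ρ) ρ = 2 := by simp [pairingM, hρ]
  have hσ : ∀ x, Module.reflection htwo x = x + BM a b x ρ • ρ := by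
    intro x
    simp [Module.reflection_apply, pairingM]
  refine ⟨Module.reflection htwo, Subgroup.subset_closure (Or.inr ⟨ρ, hρ, hρe, hσ⟩), ?_, ?_⟩
  · rw [hσ, hδρ, one_smul, BM_add_left, BM_comm a b δ, BM_comm a b ρ, BM_add_left, BM_add_left,
      BM_comm a b ρ δ, hδ, hδρ, hρ]
    norm_num
  · rw [hσ, hδρ, one_smul, BM_add_left, hρe, BM_eM, he, zero_add]
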